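/- Let U be the harmonic-type function with boundary values (x0,x1,x2). Then for all n ≥ 1, A_n(U) = (2/3)·[(3/5)ⁿ − (3/5)^{2n}]·((x0−x1)² + (x1−x2)² + (x0−x2)²). -/

import Mathlib

open MeasureTheory Filter Set
open scoped ENNReal NNReal Classical

noncomputable section

namespace SG

/-- The three vertices `p₀ = (0,0)`, `p₁ = (1,0)`, `p₂ = (1/2, √3/2)` viewed in `ℂ`. -/
def p : Fin 3 → ℂ := ![0, 1, 1/2 + (Real.sqrt 3 / 2) * Complex.I]

/-- The three contraction maps `fᵢ x = (x + pᵢ)/2`. -/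
def f (i : Fin 3) (x : ℂ) : ℂ := (x + p i) / 2

/-- `K` is the Sierpinski gasket: the (unique) nonempty compact set with
`K = f₀(K) ∪ f₁(K) ∪ f₂(K)`. -/
def IsSG (K : Set ℂ) : Prop :=
  K.Nonempty ∧ IsCompact K ∧ K = f 0 '' K ∪ f 1 '' K ∪ f 2 '' K

/-- `α = log 3 / log 2`. -/
def alpha : ℝ := Real.log 3 / Real.log 2

/-- `β* = log 5 / log 2`. -/
def betastar : ℝ := Real.log 5 / Real.log 2

/-- The normalized `α`-dimensional Hausdorff measure restricted to `K`. -/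
def nu (K : Set ℂ) : Measure ℂ :=
  ((Measure.hausdorffMeasure alpha : Measure ℂ) K)⁻¹ •
    (Measure.hausdorffMeasure alpha : Measure ℂ).restrict K

/-- `f_w` for a finite word `w` over `{0,1,2}` (empty word gives the identity). -/
def fwl : List (Fin 3) → ℂ → ℂ
  | [] => id
  | i :: t => f i ∘ fwl t

/-- `f_w` for a word `w ∈ W_n = {0,1,2}ⁿ`. -/
def fw {n : ℕ} (w : Fin n → Fin 3) : ℂ → ℂ := fwl (List.ofFn w)

/-- The cell `K_w = f_w(K)`. -/
def Kw (K : Set ℂ) {n : ℕ} (w : Fin n → Fin 3) : Set ℂ := fw w '' K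

/-- Adjacency `w⁽¹⁾ ∼ₙ w⁽²⁾`: distinct words with intersecting cells. -/
def Adj (K : Set ℂ) {n : ℕ} (w1 w2 : Fin n → Fin 3) : Prop :=
  w1 ≠ w2 ∧ (Kw K w1 ∩ Kw K w2).Nonempty

/-- `Pₙu(w) = ∫_K u(f_w(x)) ν(dx)`. -/
def P (K : Set ℂ) {n : ℕ} (u : ℂ → ℝ) (w : Fin n → Fin 3) : ℝ :=
  ∫ x, u (fw w x) ∂(nu K)

/-- `Aₙ(u)`: sum over unordered adjacent pairs in `W_n` of `(Pₙu(w⁽¹⁾) − Pₙu(w⁽²⁾))²`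
(written as half the sum over ordered pairs). -/
def A (K : Set ℂ) (n : ℕ) (u : ℂ → ℝ) : ℝ :=
  (1/2) * ∑ w1 : Fin n → Fin 3, ∑ w2 : Fin n → Fin 3,
    if Adj K w1 w2 then (P K u w1 - P K u w2)^2 else 0

/-- The remaining index of `{0,1,2}` besides `i` and `j` (when `i ≠ j`):
since `0+1+2 = 0` in `Fin 3`, it is `-(i+j)`. -/
def other (i j : Fin 3) : Fin 3 := -(i + j)

/-- `U : K → ℝ` is harmonic-type with boundary values `(x0, x1, x2)`:
continuous on `K`, `U(pᵢ) = xᵢ`, and for every finite word `w` and distinct `i, j`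
(with `k` the remaining index),
`U(f_w((pᵢ+pⱼ)/2)) = (2 U(f_w(pᵢ)) + 2 U(f_w(pⱼ)) + U(f_w(p_k)))/5`. -/
def IsHarm (K : Set ℂ) (x0 x1 x2 : ℝ) (U : ℂ → ℝ) : Prop :=
  ContinuousOn U K ∧ U (p 0) = x0 ∧ U (p 1) = x1 ∧ U (p 2) = x2 ∧
  ∀ (w : List (Fin 3)) (i j : Fin 3), i ≠ j →
    U (fwl w ((p i + p j) / 2)) =
      (2 * U (fwl w (p i)) + 2 * U (fwl w (p j)) + U (fwl w (p (other i j)))) / 5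

open scoped Topology


/-! ### Barycentric coordinates -/

/-- The barycentric coordinates of a point with respect to `p 0`, `p 1`, `p 2`. -/
def bary (j : Fin 3) (x : ℂ) : ℝ :=
  ![1 - x.re - x.im / √3, x.re - x.im / √3, 2 * x.im / √3] j

lemma bary_f (i j : Fin 3) (x : ℂ) :
    bary j (f i x) = (bary j x + if i = j then 1 else 0) / 2 := by
  have h3 : √3 ≠ 0 := by positivity
  fin_cases i <;> fin_cases j <;> simp [bary, f, p] <;> field_simp <;> ring

lemma sum_bary (x : ℂ) : ∑ j, bary j x = 1 := by
  have h3 : √3 ≠ 0 := by positivity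
  simp only [bary, Fin.sum_univ_three]
  simp
  ring

lemma f_p_self (i : Fin 3) : f i (p i) = p i := by simp [f]

lemma bary_p (i j : Fin 3) : bary j (p i) = if i = j then 1 else 0 := by
  have := bary_f i j (p i)
  rw [f_p_self] at this
  linarith

lemma bary_injective {x y : ℂ} (h : ∀ j, bary j x = bary j y) : x = y := by
  have h3 : √3 ≠ 0 := by positivity
  have h1 := h 1
  have h2 := h 2
  simp only [bary, Matrix.cons_val] at h1 h2
  have him : x.im = y.im := by
    field_simp at h2
    linarith
  rw [him] at h1
  exact Complex.ext (by linarith) him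

lemma abs_bary_sub_le (j : Fin 3) (x y : ℂ) : |bary j x - bary j y| ≤ 2 * dist x y := by
  have hre : |x.re - y.re| ≤ dist x y := by
    simpa [Complex.dist_eq] using Complex.abs_re_le_norm (x - y)
  have him : |x.im - y.im| ≤ dist x y := by
    simpa [Complex.dist_eq] using Complex.abs_im_le_norm (x - y)
  have h3 : 1 ≤ √3 := Real.one_le_sqrt.2 (by norm_num)
  have hd : |(x.im - y.im) / √3| ≤ dist x y := by
    rw [abs_div, abs_of_pos (by positivity : 0 < √3)]
    exact (div_le_self (abs_nonneg _) h3).trans him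
  have hs : (x.im - y.im) / √3 = x.im / √3 - y.im / √3 := sub_div ..
  rw [hs] at hd
  rw [abs_le] at *
  fin_cases j <;> simp [bary, mul_div_assoc] <;> constructor <;> linarith

lemma continuous_bary (j : Fin 3) : Continuous (bary j) := by
  refine LipschitzWith.continuous (K := 2) (LipschitzWith.of_dist_le_mul fun x y => ?_)
  simpa [Real.dist_eq] using abs_bary_sub_le j x y

/-! ### The contractions -/

lemma continuous_f (i : Fin 3) : Continuous (f i) := by
  unfold f
  fun_prop

lemma f_injective (i : Fin 3) : Function.Injective (f i) := fun x y h => by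
  simpa [f] using h

lemma dist_f (i : Fin 3) (x y : ℂ) : dist (f i x) (f i y) = dist x y / 2 := by
  simp only [f, Complex.dist_eq]
  rw [← sub_div]
  simp

lemma measurableEmbedding_f (i : Fin 3) : MeasurableEmbedding (f i) :=
  (continuous_f i).measurableEmbedding (f_injective i)

lemma dist_fwl (w : List (Fin 3)) (x y : ℂ) :
    dist (fwl w x) (fwl w y) = dist x y / 2 ^ w.length := by
  induction w with
  | nil => simp [fwl]
  | cons i t ih =>
    simp only [fwl, Function.comp_apply, dist_f, ih, List.length_cons, pow_succ]
    field_simp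

lemma fw_cons {n : ℕ} (i : Fin 3) (w : Fin n → Fin 3) :
    fw (Fin.cons i w : Fin (n + 1) → Fin 3) = f i ∘ fw w := by
  simp [fw, fwl]

section Gasket

variable {K : Set ℂ}

lemma IsSG.iUnion_eq (hK : IsSG K) : ⋃ i, f i '' K = K := by
  conv_rhs => rw [hK.2.2]
  ext x
  simp [Fin.exists_fin_succ, or_assoc]

lemma IsSG.mapsTo_f (hK : IsSG K) (i : Fin 3) : MapsTo (f i) K K := fun x hx => by
  rw [← hK.iUnion_eq]
  exact mem_iUnion.2 ⟨i, mem_image_of_mem _ hx⟩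

lemma IsSG.exists_eq_f (hK : IsSG K) {x : ℂ} (hx : x ∈ K) : ∃ i, ∃ y ∈ K, f i y = x := by
  rw [← hK.iUnion_eq] at hx
  simpa using hx

lemma IsSG.mapsTo_fwl (hK : IsSG K) (w : List (Fin 3)) : MapsTo (fwl w) K K := by
  induction w with
  | nil => exact mapsTo_id K
  | cons i t ih => exact (hK.mapsTo_f i).comp ih

lemma IsSG.infDist_f_le (hK : IsSG K) (i : Fin 3) (x : ℂ) :
    Metric.infDist (f i x) K ≤ Metric.infDist x K / 2 := by
  obtain ⟨y, hy, hxy⟩ := hK.2.1.exists_infDist_eq_dist hK.1 x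
  rw [hxy, ← dist_f i]
  exact Metric.infDist_le_dist_of_mem (hK.mapsTo_f i hy)

lemma IsSG.mem_of_infDist_le (hK : IsSG K) {x : ℂ} (h : Metric.infDist x K ≤ 0) : x ∈ K :=
  (hK.2.1.isClosed.mem_iff_infDist_zero hK.1).2 (le_antisymm h Metric.infDist_nonneg)

lemma IsSG.p_mem (hK : IsSG K) (i : Fin 3) : p i ∈ K := by
  have := hK.infDist_f_le i (p i)
  rw [f_p_self] at this
  exact hK.mem_of_infDist_le (by linarith)

lemma IsSG.bary_nonneg (hK : IsSG K) (j : Fin 3) {x : ℂ} (hx : x ∈ K) : 0 ≤ bary j x := by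
  obtain ⟨z, hz, hmin⟩ := hK.2.1.exists_isMinOn hK.1 (continuous_bary j).continuousOn
  obtain ⟨i, y, hy, rfl⟩ := hK.exists_eq_f hz
  have h1 := isMinOn_iff.1 hmin y hy
  have h2 := isMinOn_iff.1 hmin x hx
  rw [bary_f] at h1 h2
  split_ifs at h1 h2 <;> linarith

lemma IsSG.bary_le_one (hK : IsSG K) (j : Fin 3) {x : ℂ} (hx : x ∈ K) : bary j x ≤ 1 := by
  rw [← sum_bary x]
  exact Finset.single_le_sum (fun i _ => hK.bary_nonneg i hx) (Finset.mem_univ j)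

lemma IsSG.eq_p_of_bary_eq_one (hK : IsSG K) {j : Fin 3} {x : ℂ} (hx : x ∈ K)
    (h : bary j x = 1) : x = p j := by
  refine bary_injective fun k => ?_
  rw [bary_p]
  split_ifs with hjk
  · rw [← hjk, h]
  · refine le_antisymm ?_ (hK.bary_nonneg k hx)
    have := Finset.add_le_sum (fun i _ => hK.bary_nonneg i hx) (Finset.mem_univ j)
      (Finset.mem_univ k) hjk
    rw [sum_bary, h] at this
    linarith

/-- Two different first-level cells can only meet in the midpoint of the corresponding side. -/
lemma IsSG.eq_p_of_f_eq_f (hK : IsSG K) {i j : Fin 3} (hij : i ≠ j) {x y : ℂ} (hx : x ∈ K)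
    (hy : y ∈ K) (h : f i x = f j y) : x = p j ∧ y = p i := by
  have h1 := congrArg (bary i) h
  have h2 := congrArg (bary j) h
  rw [bary_f, bary_f] at h1 h2
  simp only [if_true, hij, hij.symm, if_false] at h1 h2
  have := hK.bary_nonneg i hx
  have := hK.bary_nonneg j hy
  have := hK.bary_le_one j hx
  have := hK.bary_le_one i hy
  exact ⟨hK.eq_p_of_bary_eq_one hx (by linarith), hK.eq_p_of_bary_eq_one hy (by linarith)⟩

/-! ### Adjacency of words -/

lemma const_eq_cons (n : ℕ) (j : Fin 3) :
    (fun _ => j : Fin (n + 1) → Fin 3) = Fin.cons j fun _ => j := by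
  funext k
  refine Fin.cases ?_ (fun _ => ?_) k <;> simp

lemma IsSG.p_mem_Kw_iff (hK : IsSG K) {n : ℕ} (w : Fin n → Fin 3) (j : Fin 3) :
    p j ∈ Kw K w ↔ w = fun _ => j := by
  induction n with
  | zero => exact ⟨fun _ => Subsingleton.elim _ _, fun _ => ⟨p j, hK.p_mem j, by simp [fw, fwl]⟩⟩
  | succ n ih =>
    induction w using Fin.consCases with
    | cons i w =>
    rw [const_eq_cons, Fin.cons_inj, ← ih w, Kw, Kw, fw_cons]
    constructor
    · rintro ⟨x, hx, h⟩
      have hw : fw w x ∈ K := hK.mapsTo_fwl _ hx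
      have hb := congrArg (bary j) h
      have h1 := hK.bary_le_one j hw
      rw [Function.comp_apply, bary_f, bary_p, if_pos rfl] at hb
      split_ifs at hb with hij
      · exact ⟨hij, x, hx, hK.eq_p_of_bary_eq_one hw (by linarith)⟩
      · linarith
    · rintro ⟨rfl, x, hx, h⟩
      exact ⟨x, hx, by simp [h, f]⟩

lemma adj_cons_self_iff {n : ℕ} (i : Fin 3) (w w' : Fin n → Fin 3) :
    Adj K (Fin.cons i w : Fin (n + 1) → Fin 3) (Fin.cons i w') ↔ Adj K w w' := by
  simp only [Adj, Kw, fw_cons, image_comp, ne_eq, Fin.cons_inj, true_and]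
  rw [← image_inter (f_injective i), image_nonempty]

lemma IsSG.adj_cons_iff_of_ne (hK : IsSG K) {n : ℕ} {i j : Fin 3} (hij : i ≠ j)
    (w w' : Fin n → Fin 3) :
    Adj K (Fin.cons i w : Fin (n + 1) → Fin 3) (Fin.cons j w') ↔
      w = (fun _ => j) ∧ w' = fun _ => i := by
  rw [← hK.p_mem_Kw_iff, ← hK.p_mem_Kw_iff]
  simp only [Adj, Kw, fw_cons, image_comp, ne_eq, Fin.cons_inj, hij, false_and,
    not_false_eq_true, true_and]
  constructor
  · rintro ⟨_, ⟨x, hx, rfl⟩, y, hy, h⟩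
    have hx' : x ∈ K := (hK.mapsTo_fwl _).image_subset hx
    have hy' : y ∈ K := (hK.mapsTo_fwl _).image_subset hy
    obtain ⟨rfl, rfl⟩ := hK.eq_p_of_f_eq_f hij hx' hy' h.symm
    exact ⟨hx, hy⟩
  · rintro ⟨h1, h2⟩
    exact ⟨f i (p j), mem_image_of_mem _ h1, p i, h2, by simp [f, add_comm]⟩

end Gasket

/-! ### The Hausdorff measure of the gasket is finite -/

lemma alpha_pos : 0 < alpha := div_pos (Real.log_pos (by norm_num)) (Real.log_pos (by norm_num))

lemma two_rpow_alpha : (2 : ℝ) ^ alpha = 3 := by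
  rw [Real.rpow_def_of_pos (by norm_num), alpha,
    mul_div_cancel₀ _ (Real.log_pos (by norm_num : (1 : ℝ) < 2)).ne', Real.exp_log (by norm_num)]

lemma inv_two_rpow_alpha : (2⁻¹ : ℝ≥0∞) ^ alpha = 3⁻¹ := by
  have h : (2 : ℝ≥0∞) ^ alpha = 3 := by
    have := ENNReal.ofReal_rpow_of_pos (p := alpha) (by norm_num : (0 : ℝ) < 2)
    rw [two_rpow_alpha] at this
    simpa using this
  rw [ENNReal.inv_rpow, h]

lemma inv_two_pow_rpow_alpha (n : ℕ) : ((2⁻¹ : ℝ≥0∞) ^ n) ^ alpha = 3⁻¹ ^ n := by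
  rw [← inv_two_rpow_alpha, ← ENNReal.rpow_natCast, ← ENNReal.rpow_mul, mul_comm,
    ENNReal.rpow_mul, ENNReal.rpow_natCast]

section Gasket

variable {K : Set ℂ}

lemma IsSG.iUnion_Kw (hK : IsSG K) (n : ℕ) : K ⊆ ⋃ w : Fin n → Fin 3, Kw K w := by
  induction n with
  | zero => exact fun x hx => mem_iUnion.2 ⟨Fin.elim0, x, hx, by simp [fw, fwl]⟩
  | succ n ih =>
    intro x hx
    obtain ⟨i, y, hy, rfl⟩ := hK.exists_eq_f hx
    obtain ⟨w, z, hz, rfl⟩ := mem_iUnion.1 (ih hy)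
    exact mem_iUnion.2 ⟨Fin.cons i w, z, hz, by simp [fw_cons]⟩

lemma ediam_Kw_le {n : ℕ} (w : Fin n → Fin 3) :
    Metric.ediam (Kw K w) ≤ 2⁻¹ ^ n * Metric.ediam K := by
  have h : LipschitzWith (2⁻¹ ^ n) (fw w) := LipschitzWith.of_dist_le_mul fun x y => by
    rw [fw, dist_fwl]
    simp [div_eq_inv_mul]
  simpa [Kw, ENNReal.inv_pow] using h.ediam_image_le K

lemma IsSG.hausdorffMeasure_lt_top (hK : IsSG K) : Measure.hausdorffMeasure alpha K < ∞ := by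
  have hD : Metric.ediam K ≠ ∞ := hK.2.1.isBounded.ediam_ne_top
  have hr : Tendsto (fun n : ℕ => (2⁻¹ : ℝ≥0∞) ^ n * Metric.ediam K) atTop (𝓝 0) := by
    simpa using ENNReal.Tendsto.mul_const
      (ENNReal.tendsto_pow_atTop_nhds_zero_of_lt_one (by simp : (2⁻¹ : ℝ≥0∞) < 1)) (Or.inr hD)
  refine (Measure.hausdorffMeasure_le_liminf_sum alpha K _ hr (fun n w => Kw K w)
    (.of_forall fun n w => ediam_Kw_le w) (.of_forall hK.iUnion_Kw)).trans_lt ?_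
  refine lt_of_le_of_lt (b := Metric.ediam K ^ alpha) ?_
    (ENNReal.rpow_lt_top_of_nonneg alpha_pos.le hD)
  refine (liminf_le_liminf (.of_forall fun n => ?_)).trans (liminf_const _).le
  calc ∑ w : Fin n → Fin 3, Metric.ediam (Kw K w) ^ alpha
      ≤ ∑ w : Fin n → Fin 3, 3⁻¹ ^ n * Metric.ediam K ^ alpha := by
        refine Finset.sum_le_sum fun w _ => ?_
        rw [← inv_two_pow_rpow_alpha, ← ENNReal.mul_rpow_of_nonneg _ _ alpha_pos.le]
        exact ENNReal.rpow_le_rpow (ediam_Kw_le w) alpha_pos.le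
    _ = Metric.ediam K ^ alpha := by
        rw [Finset.sum_const, nsmul_eq_mul, ← mul_assoc]
        simp [← mul_pow, ENNReal.mul_inv_cancel]

end Gasket

/-! ### The Hausdorff measure of the gasket is positive -/

/-- The point of the gasket with address `ω`. -/
def addr (ω : ℕ → Fin 3) : ℂ := ∑' n, (1 / 2) ^ (n + 1) * p (ω n)

lemma norm_p_le (i : Fin 3) : ‖p i‖ ≤ 1 := by
  fin_cases i
  · simp [p]
  · simp [p]
  · have h : (√3) ^ 2 = 3 := Real.sq_sqrt (by norm_num)
    rw [← sq_le_one_iff₀ (norm_nonneg _), ← Complex.normSq_eq_norm_sq, Complex.normSq_apply]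
    simp [p]
    nlinarith

lemma norm_addr_term_le (ω : ℕ → Fin 3) (n : ℕ) :
    ‖(1 / 2 : ℂ) ^ (n + 1) * p (ω n)‖ ≤ (1 / 2) ^ (n + 1) := by
  rw [norm_mul, norm_pow]
  norm_num
  exact norm_p_le _

lemma summable_half_pow_succ : Summable fun n : ℕ => (1 / 2 : ℝ) ^ (n + 1) :=
  (summable_nat_add_iff 1).2 summable_geometric_two

lemma continuous_addr : Continuous addr := by
  refine continuous_tsum (fun n => ?_) summable_half_pow_succ fun n ω => norm_addr_term_le ω n
  exact continuous_const.mul (continuous_of_discreteTopology.comp (continuous_apply n))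

lemma addr_eq_f (ω : ℕ → Fin 3) : addr ω = f (ω 0) (addr fun n => ω (n + 1)) := by
  have hs : ∀ ω : ℕ → Fin 3, Summable fun n => (1 / 2 : ℂ) ^ (n + 1) * p (ω n) := fun ω =>
    Summable.of_norm_bounded summable_half_pow_succ (norm_addr_term_le ω)
  rw [addr, (hs ω).tsum_eq_zero_add, f, addr, add_div, ← tsum_div_const, add_comm]
  congr 1
  · exact tsum_congr fun n => by ring
  · ring

lemma norm_addr_le (ω : ℕ → Fin 3) : ‖addr ω‖ ≤ 1 := by
  refine tsum_of_norm_bounded ?_ (norm_addr_term_le ω)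
  have := hasSum_geometric_two.mul_left (1 / 2)
  norm_num at this
  simpa [pow_succ'] using this

lemma IsSG.addr_mem {K : Set ℂ} (hK : IsSG K) (ω : ℕ → Fin 3) : addr ω ∈ K := by
  have h : ∀ (n : ℕ) (ω : ℕ → Fin 3), Metric.infDist (addr ω) K ≤ 2 * (1 / 2) ^ n := by
    intro n
    induction n with
    | zero =>
      intro ω
      refine (Metric.infDist_le_dist_of_mem (hK.p_mem 0)).trans ((dist_le_norm_add_norm _ _).trans ?_)
      linarith [norm_addr_le ω, norm_p_le 0]
    | succ n ih =>
      intro ω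
      rw [addr_eq_f]
      refine (hK.infDist_f_le _ _).trans ?_
      rw [pow_succ]
      linarith [ih fun n => ω (n + 1)]
  have hlim : Tendsto (fun n : ℕ => (2 : ℝ) * (1 / 2) ^ n) atTop (𝓝 0) := by
    simpa using (tendsto_pow_atTop_nhds_zero_of_lt_one
      (by norm_num : (0 : ℝ) ≤ 1 / 2) (by norm_num)).const_mul 2
  exact hK.mem_of_infDist_le (ge_of_tendsto' hlim fun n => h n ω)

/-- The integer whose binary digits record the positions of the letter `j` among the first `n`
letters of `ω`. -/
def digits (ω : ℕ → Fin 3) (j : Fin 3) : ℕ → ℤ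
  | 0 => 0
  | n + 1 => 2 * digits ω j n + if ω n = j then 1 else 0

lemma bary_addr (ω : ℕ → Fin 3) (j : Fin 3) (n : ℕ) :
    2 ^ n * bary j (addr ω) = digits ω j n + bary j (addr fun k => ω (n + k)) := by
  induction n with
  | zero => simp [digits]
  | succ n ih =>
    rw [pow_succ', mul_assoc, ih, addr_eq_f fun k => ω (n + k), bary_f]
    have h : (fun k => ω (n + (k + 1))) = fun k => ω (n + 1 + k) := by
      funext k
      rw [add_right_comm, add_assoc]
    rw [h]
    simp only [digits, add_zero]
    push_cast
    ring

lemma eq_of_digits_eq {ω ω' : ℕ → Fin 3} {n : ℕ} (h : ∀ j, digits ω j n = digits ω' j n) :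
    ∀ k < n, ω k = ω' k := by
  induction n with
  | zero => simp
  | succ n ih =>
    have key : ∀ j, digits ω j n = digits ω' j n ∧ (ω n = j ↔ ω' n = j) := fun j => by
      have := h j
      simp only [digits] at this
      split_ifs at this with h1 h2 h2
      · exact ⟨by omega, iff_of_true h1 h2⟩
      · omega
      · omega
      · exact ⟨by omega, iff_of_false h1 h2⟩
    intro k hk
    rcases Nat.lt_succ_iff_lt_or_eq.1 hk with hk | rfl
    · exact ih (fun j => (key j).1) k hk
    · exact ((key (ω k)).2.1 rfl).symm

/-- The uniform Bernoulli measure on addresses. -/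
def addrMeasure : Measure (ℕ → Fin 3) :=
  Measure.infinitePi fun _ => ProbabilityTheory.uniformOn (univ : Set (Fin 3))

instance : IsProbabilityMeasure (ProbabilityTheory.uniformOn (univ : Set (Fin 3))) :=
  ProbabilityTheory.isProbabilityMeasure_uniformOn finite_univ univ_nonempty

instance : IsProbabilityMeasure addrMeasure := by
  unfold addrMeasure
  infer_instance

lemma addrMeasure_digits_le (n : ℕ) (v : Fin 3 → ℤ) :
    addrMeasure {ω | ∀ j, digits ω j n = v j} ≤ 3⁻¹ ^ n := by
  rcases eq_empty_or_nonempty {ω : ℕ → Fin 3 | ∀ j, digits ω j n = v j} with h | ⟨ω₀, h₀⟩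
  · simp [h]
  have hsub : {ω : ℕ → Fin 3 | ∀ j, digits ω j n = v j} ⊆
      Set.pi (Finset.range n : Finset ℕ) fun k => {ω₀ k} := fun ω hω k hk =>
    eq_of_digits_eq (fun j => (hω j).trans (h₀ j).symm) k (by simpa using hk)
  refine (measure_mono hsub).trans ?_
  rw [addrMeasure, Measure.infinitePi_pi _ (fun _ _ => measurableSet_singleton _)]
  simp [ProbabilityTheory.uniformOn_univ]

lemma IsSG.addrMeasure_preimage_le {K : Set ℂ} (hK : IsSG K) {n : ℕ} {S : Set ℂ}
    (hS : Metric.ediam S ≤ 2⁻¹ ^ n) : addrMeasure (addr ⁻¹' S) ≤ 343 * 3⁻¹ ^ n := by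
  rcases S.eq_empty_or_nonempty with rfl | ⟨x₀, hx₀⟩
  · simp
  have hdist : ∀ x ∈ S, 2 ^ n * dist x x₀ ≤ 1 := fun x hx => by
    have h := (Metric.edist_le_ediam_of_mem hx hx₀).trans hS
    rw [edist_dist, ENNReal.ofReal_le_iff_le_toReal (by simp)] at h
    simp only [ENNReal.toReal_pow, ENNReal.toReal_inv, ENNReal.toReal_ofNat, inv_pow] at h
    rwa [← le_inv_mul_iff₀ (by positivity), mul_one]
  have hsub : addr ⁻¹' S ⊆ ⋃ d ∈ Fintype.piFinset fun _ : Fin 3 => Finset.Icc (-3 : ℤ) 3,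
      {ω | ∀ j, digits ω j n = ⌊2 ^ n * bary j x₀⌋ + d j} := by
    intro ω hω
    simp only [mem_iUnion, Fintype.mem_piFinset, Finset.mem_Icc, mem_ofPred_eq, exists_prop]
    refine ⟨fun j => digits ω j n - ⌊2 ^ n * bary j x₀⌋, fun j => ?_, fun j => by ring⟩
    have h1 := hdist _ hω
    have h2 : |2 ^ n * bary j (addr ω) - 2 ^ n * bary j x₀| ≤ 2 := by
      rw [← mul_sub, abs_mul, abs_of_pos (by positivity : (0 : ℝ) < 2 ^ n)]
      calc (2 : ℝ) ^ n * |bary j (addr ω) - bary j x₀|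
          ≤ 2 ^ n * (2 * dist (addr ω) x₀) := by gcongr; exact abs_bary_sub_le ..
        _ ≤ 2 := by linarith
    have h3 := bary_addr ω j n
    have h4 := hK.bary_nonneg j (hK.addr_mem fun k => ω (n + k))
    have h5 := hK.bary_le_one j (hK.addr_mem fun k => ω (n + k))
    have h6 := Int.floor_le (2 ^ n * bary j x₀)
    have h7 := Int.lt_floor_add_one (2 ^ n * bary j x₀)
    rw [abs_le] at h2
    have h8 : ((-3 : ℤ) : ℝ) ≤ (digits ω j n - ⌊2 ^ n * bary j x₀⌋ : ℤ) := by
      push_cast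
      linarith
    have h9 : ((digits ω j n - ⌊2 ^ n * bary j x₀⌋ : ℤ) : ℝ) ≤ (3 : ℤ) := by
      push_cast
      linarith
    exact ⟨mod_cast h8, mod_cast h9⟩
  refine (measure_mono hsub).trans ((measure_biUnion_finset_le _ _).trans ?_)
  refine (Finset.sum_le_sum fun d _ => addrMeasure_digits_le n _).trans ?_
  rw [Finset.sum_const, nsmul_eq_mul]
  simp [Fintype.card_piFinset]

lemma IsSG.addrMeasure_preimage_le_rpow {K : Set ℂ} (hK : IsSG K) {S : Set ℂ}
    (hS : Metric.ediam S ≤ 1) :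
    addrMeasure (addr ⁻¹' S) ≤ 1029 * Metric.ediam S ^ alpha := by
  rcases eq_or_ne (Metric.ediam S) 0 with h0 | h0
  · have h : Tendsto (fun n : ℕ => (343 : ℝ≥0∞) * 3⁻¹ ^ n) atTop (𝓝 0) := by
      simpa using ENNReal.Tendsto.const_mul (a := 343)
        (ENNReal.tendsto_pow_atTop_nhds_zero_of_lt_one (by simp : (3⁻¹ : ℝ≥0∞) < 1)) (by simp)
    exact (ge_of_tendsto' h fun n => hK.addrMeasure_preimage_le (by simp [h0])).trans zero_le
  have htop : Metric.ediam S ≠ ∞ := (hS.trans_lt ENNReal.one_lt_top).ne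
  obtain ⟨n, hn, hn'⟩ := exists_nat_pow_near_of_lt_one (ENNReal.toReal_pos h0 htop)
    (ENNReal.toReal_le_of_le_ofReal zero_le_one (by simpa using hS))
    (by norm_num : (0 : ℝ) < 2⁻¹) (by norm_num)
  have e : ∀ m : ℕ, ENNReal.ofReal (2⁻¹ ^ m) = 2⁻¹ ^ m := fun m => by
    rw [ENNReal.ofReal_pow (by norm_num), ENNReal.ofReal_inv_of_pos (by norm_num)]
    simp
  have h1 : Metric.ediam S ≤ 2⁻¹ ^ n := by
    rw [← e]
    exact ENNReal.le_ofReal_iff_toReal_le htop (by positivity) |>.2 hn'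
  have h2 : (2⁻¹ : ℝ≥0∞) ^ (n + 1) ≤ Metric.ediam S := by
    rw [← e]
    exact ENNReal.ofReal_le_of_le_toReal hn.le
  refine (hK.addrMeasure_preimage_le h1).trans ?_
  calc (343 : ℝ≥0∞) * 3⁻¹ ^ n = 1029 * 3⁻¹ ^ (n + 1) := by
        rw [pow_succ', ← mul_assoc]
        congr 1
        rw [show (1029 : ℝ≥0∞) = 343 * 3 by norm_num, mul_assoc,
          ENNReal.mul_inv_cancel (by simp) (by simp), mul_one]
    _ ≤ 1029 * Metric.ediam S ^ alpha := by
        rw [← inv_two_pow_rpow_alpha]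
        gcongr
        exact alpha_pos.le

lemma IsSG.hausdorffMeasure_pos {K : Set ℂ} (hK : IsSG K) :
    0 < Measure.hausdorffMeasure alpha K := by
  have hle : (1029⁻¹ : ℝ≥0∞) • addrMeasure.map addr ≤ Measure.hausdorffMeasure alpha := by
    refine Measure.le_hausdorffMeasure _ _ 1 one_pos fun S hS => ?_
    rw [← Metric.ediam_closure] at hS ⊢
    refine (measure_mono subset_closure).trans ?_
    rw [Measure.smul_apply, Measure.map_apply continuous_addr.measurable
      isClosed_closure.measurableSet, smul_eq_mul, ENNReal.inv_mul_le_iff (by simp) (by simp)]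
    exact hK.addrMeasure_preimage_le_rpow hS
  refine lt_of_lt_of_le ?_ (hle K)
  have huniv : addr ⁻¹' K = univ := eq_univ_of_forall hK.addr_mem
  rw [Measure.smul_apply, Measure.map_apply continuous_addr.measurable
    hK.2.1.isClosed.measurableSet, huniv, measure_univ]
  simp

/-! ### Self-similarity of the normalized Hausdorff measure -/

section Gasket

variable {K : Set ℂ}

open scoped Pointwise in
lemma hausdorffMeasure_image_f (i : Fin 3) (T : Set ℂ) :
    Measure.hausdorffMeasure alpha (f i '' T) = 3⁻¹ * Measure.hausdorffMeasure alpha T := by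
  have h : f i '' T = IsometryEquiv.addRight (p i / 2) '' ((2⁻¹ : ℂ) • T) := by
    rw [← image_smul, image_image]
    refine image_congr fun x _ => ?_
    simp [f]
    ring
  rw [h, IsometryEquiv.hausdorffMeasure_image,
    Measure.hausdorffMeasure_smul₀ alpha_pos.le (by norm_num), ENNReal.smul_def,
    ENNReal.coe_rpow_of_nonneg _ alpha_pos.le, smul_eq_mul]
  simp [inv_two_rpow_alpha]

lemma IsSG.measurableSet (hK : IsSG K) : MeasurableSet K := hK.2.1.isClosed.measurableSet

lemma restrict_image_f (i : Fin 3) (T : Set ℂ) :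
    (Measure.hausdorffMeasure alpha).restrict (f i '' T) =
      (3⁻¹ : ℝ≥0∞) • ((Measure.hausdorffMeasure alpha).restrict T).map (f i) := by
  ext s hs
  rw [Measure.restrict_apply hs, Measure.smul_apply,
    Measure.map_apply (continuous_f i).measurable hs,
    Measure.restrict_apply ((continuous_f i).measurable hs), ← image_preimage_inter,
    hausdorffMeasure_image_f, smul_eq_mul]

lemma IsSG.restrict_eq (hK : IsSG K) :
    (Measure.hausdorffMeasure alpha).restrict K =
      (3⁻¹ : ℝ≥0∞) • ∑ i, ((Measure.hausdorffMeasure alpha).restrict K).map (f i) := by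
  have hd : Pairwise (Function.onFun (AEDisjoint (Measure.hausdorffMeasure alpha : Measure ℂ))
      fun i => f i '' K) := by
    intro i j hij
    have := Measure.nullSingletonClass_hausdorff ℂ alpha_pos
    refine measure_mono_null (t := {f i (p j)}) ?_ (measure_singleton _)
    rintro _ ⟨⟨x, hx, rfl⟩, y, hy, h⟩
    rw [mem_singleton_iff, (hK.eq_p_of_f_eq_f hij hx hy h.symm).1]
  conv_lhs => rw [← hK.iUnion_eq]
  rw [Measure.restrict_iUnion_ae hd fun i =>
    ((measurableEmbedding_f i).measurableSet_image.2 hK.measurableSet).nullMeasurableSet,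
    Measure.sum_fintype, Finset.smul_sum]
  exact Finset.sum_congr rfl fun i _ => restrict_image_f i K

lemma IsSG.nu_eq (hK : IsSG K) : nu K = (3⁻¹ : ℝ≥0∞) • ∑ i, (nu K).map (f i) := by
  conv_lhs => rw [nu, hK.restrict_eq]
  rw [smul_comm, Finset.smul_sum]
  simp only [nu, Measure.map_smul]

lemma IsSG.isProbabilityMeasure_nu (hK : IsSG K) : IsProbabilityMeasure (nu K) := by
  refine ⟨?_⟩
  rw [nu, Measure.smul_apply, Measure.restrict_apply_univ, smul_eq_mul]
  exact ENNReal.inv_mul_cancel hK.hausdorffMeasure_pos.ne' hK.hausdorffMeasure_lt_top.ne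

lemma IsSG.ae_mem (hK : IsSG K) : ∀ᵐ x ∂nu K, x ∈ K :=
  Measure.ae_smul_measure (ae_restrict_mem hK.measurableSet) _

lemma IsSG.integrable (hK : IsSG K) {g : ℂ → ℝ} (hg : ContinuousOn g K) :
    Integrable g (nu K) := by
  have := hK.isProbabilityMeasure_nu
  obtain ⟨C, hC⟩ := hK.2.1.exists_bound_of_continuousOn hg
  exact .of_bound ((hg.aestronglyMeasurable hK.measurableSet).smul_measure _) C
    (hK.ae_mem.mono hC)

lemma IsSG.continuousOn_comp_f (hK : IsSG K) {g : ℂ → ℝ} (hg : ContinuousOn g K) (i : Fin 3) :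
    ContinuousOn (g ∘ f i) K :=
  hg.comp (continuous_f i).continuousOn (hK.mapsTo_f i)

lemma IsSG.integral_eq (hK : IsSG K) {g : ℂ → ℝ} (hg : ContinuousOn g K) :
    ∫ x, g x ∂nu K = (∑ i, ∫ x, (g ∘ f i) x ∂nu K) / 3 := by
  conv_lhs => rw [hK.nu_eq]
  rw [integral_smul_measure, integral_finsetSum_measure]
  · simp only [(measurableEmbedding_f _).integral_map, Function.comp_apply]
    simp [div_eq_inv_mul]
  · exact fun i _ => (measurableEmbedding_f i).integrable_map_iff.2
      (hK.integrable (hK.continuousOn_comp_f hg i))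

/-! ### Harmonic-type functions -/

variable {x0 x1 x2 : ℝ} {U : ℂ → ℝ}

/-- The mean of the boundary values of `U`. -/
def bdryMean (U : ℂ → ℝ) : ℝ := (∑ k, U (p k)) / 3

lemma IsHarm.comp_f (hK : IsSG K) (hU : IsHarm K x0 x1 x2 U) (i : Fin 3) :
    IsHarm K (U (f i (p 0))) (U (f i (p 1))) (U (f i (p 2))) (U ∘ f i) :=
  ⟨hK.continuousOn_comp_f hU.1 i, rfl, rfl, rfl, fun w => hU.2.2.2.2 (i :: w)⟩

lemma IsHarm.apply_f (hU : IsHarm K x0 x1 x2 U) {i j : Fin 3} (hij : i ≠ j) :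
    U (f i (p j)) = (∑ k, U (p k) + U (p i) + U (p j)) / 5 := by
  have h := hU.2.2.2.2 [] i j hij
  have hs : U (p i) + U (p j) + U (p (other i j)) = ∑ k, U (p k) := by
    rw [Fin.sum_univ_three]
    have h1 : (-1 : Fin 3) = 2 := rfl
    have h2 : (-2 : Fin 3) = 1 := rfl
    fin_cases i <;> fin_cases j <;> simp [other, h1, h2] at hij ⊢ <;> ring
  rw [← hs, f, add_comm (p j)]
  simp only [fwl, id_eq] at h
  rw [h]
  ring

lemma IsHarm.bdryMean_eq (hU : IsHarm K x0 x1 x2 U) :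
    bdryMean U = (∑ i, bdryMean (U ∘ f i)) / 3 := by
  simp [bdryMean, Fin.sum_univ_three, f_p_self, hU.apply_f]
  ring

lemma IsHarm.abs_integral_sub_le (hK : IsSG K) {ε : ℝ} (k : ℕ) (hU : IsHarm K x0 x1 x2 U)
    (h : ∀ w : List (Fin 3), w.length = k →
      |∫ x, (U ∘ fwl w) x ∂nu K - bdryMean (U ∘ fwl w)| ≤ ε) :
    |∫ x, U x ∂nu K - bdryMean U| ≤ ε := by
  induction k generalizing U x0 x1 x2 with
  | zero => exact h [] rfl
  | succ k ih =>
    have hi : ∀ i, |∫ x, (U ∘ f i) x ∂nu K - bdryMean (U ∘ f i)| ≤ ε := fun i =>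
      ih (hU.comp_f hK i) fun w hw => h (i :: w) (by simp [hw])
    rw [hK.integral_eq hU.1, hU.bdryMean_eq, ← sub_div, ← Finset.sum_sub_distrib, abs_div,
      abs_of_pos (by norm_num : (0 : ℝ) < 3), div_le_iff₀ (by norm_num)]
    refine (Finset.abs_sum_le_sum_abs _ _).trans ((Finset.sum_le_sum fun i _ => hi i).trans ?_)
    simp [mul_comm]

lemma IsSG.abs_integral_sub_bdryMean_le (hK : IsSG K) {g : ℂ → ℝ} (hg : ContinuousOn g K) {ε : ℝ}
    (h : ∀ x ∈ K, ∀ y ∈ K, |g x - g y| ≤ ε) : |∫ x, g x ∂nu K - bdryMean g| ≤ ε := by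
  have := hK.isProbabilityMeasure_nu
  have hb : ∀ x ∈ K, ‖g x - bdryMean g‖ ≤ ε := fun x hx => by
    have hk := fun k => h x hx (p k) (hK.p_mem k)
    have h0 := abs_le.1 (hk 0)
    have h1 := abs_le.1 (hk 1)
    have h2 := abs_le.1 (hk 2)
    rw [bdryMean, Fin.sum_univ_three, Real.norm_eq_abs, abs_le]
    constructor <;> linarith
  have hint := norm_integral_le_of_norm_le_const (hK.ae_mem.mono hb)
  rw [integral_sub (hK.integrable hg) (integrable_const _)] at hint
  simpa using hint

lemma IsSG.continuousOn_comp_fwl (hK : IsSG K) {g : ℂ → ℝ} (hg : ContinuousOn g K)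
    (w : List (Fin 3)) : ContinuousOn (g ∘ fwl w) K := by
  induction w generalizing g with
  | nil => exact hg
  | cons i t ih => exact ih (hK.continuousOn_comp_f hg i)

lemma IsHarm.integral_eq_bdryMean (hK : IsSG K) (hU : IsHarm K x0 x1 x2 U) :
    ∫ x, U x ∂nu K = bdryMean U := by
  rw [← sub_eq_zero, ← abs_nonpos_iff]
  refine le_of_forall_pos_le_add fun ε hε => ?_
  rw [zero_add]
  obtain ⟨δ, hδ, hUδ⟩ := Metric.uniformContinuousOn_iff.1
    (hK.2.1.uniformContinuousOn_of_continuous hU.1) ε hε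
  obtain ⟨k, hk⟩ := pow_unbounded_of_one_lt (Metric.diam K / δ) (by norm_num : (1 : ℝ) < 2)
  refine hU.abs_integral_sub_le hK k fun w hw => ?_
  refine hK.abs_integral_sub_bdryMean_le (hK.continuousOn_comp_fwl hU.1 w) fun x hx y hy => ?_
  refine (hUδ _ (hK.mapsTo_fwl w hx) _ (hK.mapsTo_fwl w hy) ?_).le
  rw [dist_fwl, hw, div_lt_iff₀ (by positivity), mul_comm, ← div_lt_iff₀ hδ]
  refine lt_of_le_of_lt ?_ hk
  gcongr
  exact Metric.dist_le_diam_of_mem hK.2.1.isBounded hx hy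

/-! ### The recursion for `A` -/

lemma P_cons {n : ℕ} (U : ℂ → ℝ) (i : Fin 3) (w : Fin n → Fin 3) :
    P K U (Fin.cons i w : Fin (n + 1) → Fin 3) = P K (U ∘ f i) w := by
  simp [P, fw_cons]

lemma IsHarm.P_const (hK : IsSG K) (hU : IsHarm K x0 x1 x2 U) (n : ℕ) (j : Fin 3) :
    P K U (fun _ : Fin n => j) = U (p j) + (3 / 5) ^ n * (bdryMean U - U (p j)) := by
  induction n generalizing U x0 x1 x2 with
  | zero => simpa [P, fw, fwl] using hU.integral_eq_bdryMean hK
  | succ n ih =>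
    rw [const_eq_cons, P_cons, ih (hU.comp_f hK j), Function.comp_apply, f_p_self, pow_succ,
      mul_assoc]
    congr 2
    fin_cases j <;> simp [bdryMean, Fin.sum_univ_three, f_p_self, hU.apply_f] <;> ring

lemma sum_words_succ {n : ℕ} (F : (Fin (n + 1) → Fin 3) → ℝ) :
    ∑ w, F w = ∑ i, ∑ w : Fin n → Fin 3, F (Fin.cons i w) := by
  rw [← Fintype.sum_prod_type']
  exact (Equiv.sum_comp (Fin.consEquiv fun _ => Fin 3) F).symm

lemma IsSG.A_succ (hK : IsSG K) (n : ℕ) (U : ℂ → ℝ) :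
    A K (n + 1) U = ∑ i, A K n (U ∘ f i) + (1 / 2) * ∑ i, ∑ j, if i ≠ j then
      (P K (U ∘ f i) (fun _ : Fin n => j) - P K (U ∘ f j) (fun _ : Fin n => i)) ^ 2 else 0 := by
  have key : ∀ i j : Fin 3, (∑ w : Fin n → Fin 3, ∑ w' : Fin n → Fin 3,
      if Adj K (Fin.cons i w : Fin (n + 1) → Fin 3) (Fin.cons j w') then
        (P K U (Fin.cons i w : Fin (n + 1) → Fin 3) -
          P K U (Fin.cons j w' : Fin (n + 1) → Fin 3)) ^ 2 else 0) =
      (if i = j then 2 * A K n (U ∘ f i) else 0) + if i ≠ j then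
        (P K (U ∘ f i) (fun _ : Fin n => j) - P K (U ∘ f j) (fun _ : Fin n => i)) ^ 2 else 0 := by
    intro i j
    simp only [P_cons]
    rcases eq_or_ne i j with rfl | hij
    · simp [adj_cons_self_iff, A]
    · simp [hK.adj_cons_iff_of_ne hij, hij, ite_and]
  rw [A, sum_words_succ]
  simp only [sum_words_succ (n := n)]
  rw [Finset.sum_congr rfl fun i _ => (Finset.sum_comm.trans
    (Finset.sum_congr rfl fun j _ => key i j))]
  simp only [Finset.sum_add_distrib, Finset.sum_ite_eq, Finset.mem_univ, if_true]
  rw [mul_add, ← Finset.mul_sum]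
  ring

lemma IsHarm.A_eq (hK : IsSG K) (hU : IsHarm K x0 x1 x2 U) (n : ℕ) :
    A K n U = (2 / 3) * ((3 / 5) ^ n - (3 / 5) ^ (2 * n)) *
      ((U (p 0) - U (p 1)) ^ 2 + (U (p 1) - U (p 2)) ^ 2 + (U (p 0) - U (p 2)) ^ 2) := by
  induction n generalizing U x0 x1 x2 with
  | zero => simp [A, Adj, Subsingleton.elim _ (Fin.elim0 : Fin 0 → Fin 3)]
  | succ n ih =>
    simp only [hK.A_succ, ih (hU.comp_f hK _), (hU.comp_f hK _).P_const hK]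
    simp [bdryMean, Fin.sum_univ_three, f_p_self, hU.apply_f]
    ring

end Gasket

theorem statement7 (K : Set ℂ) (hK : IsSG K) (x0 x1 x2 : ℝ) (U : ℂ → ℝ)
    (hU : IsHarm K x0 x1 x2 U) (n : ℕ) (hn : 1 ≤ n) :
    A K n U = (2/3) * ((3/5)^n - (3/5)^(2*n)) *
      ((x0 - x1)^2 + (x1 - x2)^2 + (x0 - x2)^2) := by
  rw [hU.A_eq hK, hU.2.1, hU.2.2.1, hU.2.2.2.1]

end SG
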